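/- arXiv:1912.01049 — 2 statements merged into one kernel-verified Lean document; each statement's English description precedes it below -/
import Mathlib

section
/- (Proposition 1, positive flows.) Let r : Fin (k+1) → X be limiting profiles satisfying Condition 2 (g (r h) j ≥ g (r l) j for all criteria j whenever h < l) and Condition 7.B (π(r h, r (h+1)) > 0 for every h < k), all profiles pairwise distinct, and let a be an alternative distinct from all profiles. Then for every h < k, the positive Choquet-flows over R_a = {r 0, …, r k, a} satisfy the strict inequality φ⁺_{R_a}(r h) > φ⁺_{R_a}(r (h+1)). -/
open Finset

/-- The 2-additive Choquet integral (Möbius form). -/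
noncomputable def CI2 (n : ℕ) (m : Fin n → ℝ) (M : Fin n → Fin n → ℝ)
    (P : Fin n → ℝ) : ℝ :=
  ∑ j, m j * P j + ∑ j, ∑ s, if j < s then M j s * min (P j) (P s) else 0

/-- The Choquet-outranking degree of `x` over `y` built from evaluations `g` and
preference functions `F`. -/
noncomputable def outrank {X : Type*} (n : ℕ) (m : Fin n → ℝ) (M : Fin n → Fin n → ℝ)
    (g : X → Fin n → ℝ) (F : Fin n → ℝ → ℝ) (x y : X) : ℝ :=
  CI2 n m M (fun j => F j (g x j - g y j))

/-- The positive Choquet-flow of `x` within the finite set `S`. -/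
noncomputable def posFlow {X : Type*} [DecidableEq X] (π : X → X → ℝ)
    (S : Finset X) (x : X) : ℝ :=
  (1 / ((S.card : ℝ) - 1)) * ∑ y ∈ S.erase x, π x y

/-- The negative Choquet-flow of `x` within the finite set `S`. -/
noncomputable def negFlow {X : Type*} [DecidableEq X] (π : X → X → ℝ)
    (S : Finset X) (x : X) : ℝ :=
  (1 / ((S.card : ℝ) - 1)) * ∑ y ∈ S.erase x, π y x

/-- The net Choquet-flow of `x` within the finite set `S`. -/
noncomputable def netFlow {X : Type*} [DecidableEq X] (π : X → X → ℝ)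
    (S : Finset X) (x : X) : ℝ :=
  posFlow π S x - negFlow π S x

theorem CI2_mono {n : ℕ} {m : Fin n → ℝ} {M : Fin n → Fin n → ℝ}
    (hsymm : ∀ j s, M j s = M s j) (hdiag : ∀ j, M j j = 0)
    (hmono : ∀ j (S : Finset (Fin n)), j ∉ S → 0 ≤ m j + ∑ s ∈ S, M j s) :
    Monotone (CI2 n m M) := by
  intro P Q hPQ
  have hδ : ∀ j, 0 ≤ Q j - P j := fun j => sub_nonneg.2 (hPQ j)
  have key : ∀ j, 0 ≤ m j + ∑ s, min (M j s) 0 := by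
    intro j
    have h := hmono j (univ.filter fun s => M j s < 0) (by simp [hdiag])
    rw [sum_filter] at h
    convert h using 3 with s
    split_ifs with hs
    · exact min_eq_left hs.le
    · exact min_eq_right (not_lt.1 hs)
  have hpair : ∀ j s, min (M j s) 0 * ((Q j - P j) + (Q s - P s))
      ≤ M j s * min (Q j) (Q s) - M j s * min (P j) (P s) := by
    intro j s
    have h1 : min (P j) (P s) ≤ min (Q j) (Q s) := min_le_min (hPQ j) (hPQ s)
    have h2 : min (Q j) (Q s) - min (P j) (P s) ≤ (Q j - P j) + (Q s - P s) := by
      have h3 := min_le_left (Q j) (Q s)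
      have h4 := min_le_right (Q j) (Q s)
      rcases min_choice (P j) (P s) with h | h <;> rw [h] <;> linarith [hδ j, hδ s]
    rw [← mul_sub]
    rcases le_total (M j s) 0 with h | h
    · rw [min_eq_left h]
      exact mul_le_mul_of_nonpos_left h2 h
    · rw [min_eq_right h, zero_mul]
      exact mul_nonneg h (sub_nonneg.2 h1)
  have hswap : ∑ j, ∑ s, (if j < s then min (M j s) 0 * ((Q j - P j) + (Q s - P s)) else 0)
      = ∑ j, (∑ s, min (M j s) 0) * (Q j - P j) := by
    have hsplit : ∀ j s,
        (if j < s then min (M j s) 0 * ((Q j - P j) + (Q s - P s)) else 0)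
        = (if j < s then min (M j s) 0 * (Q j - P j) else 0)
          + (if j < s then min (M j s) 0 * (Q s - P s) else 0) := by
      intro j s
      split_ifs <;> ring
    simp_rw [hsplit, sum_add_distrib]
    rw [sum_comm (f := fun j s => if j < s then min (M j s) 0 * (Q s - P s) else 0)]
    simp_rw [← sum_add_distrib, sum_mul]
    refine sum_congr rfl fun j _ => sum_congr rfl fun s _ => ?_
    rcases lt_trichotomy j s with h | rfl | h
    · simp [h, h.not_gt]
    · simp [hdiag]
    · simp [h, h.not_gt, hsymm s j]
  have hdiff : 0 ≤ ∑ j, m j * (Q j - P j)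
      + ∑ j, ∑ s, (if j < s then min (M j s) 0 * ((Q j - P j) + (Q s - P s)) else 0) := by
    rw [hswap, ← sum_add_distrib]
    refine sum_nonneg fun j _ => ?_
    rw [← add_mul]
    exact mul_nonneg (key j) (hδ j)
  have hle : ∑ j, ∑ s, (if j < s then min (M j s) 0 * ((Q j - P j) + (Q s - P s)) else 0)
      ≤ (∑ j, ∑ s, if j < s then M j s * min (Q j) (Q s) else 0)
        - ∑ j, ∑ s, if j < s then M j s * min (P j) (P s) else 0 := by
    simp_rw [← sum_sub_distrib]
    refine sum_le_sum fun j _ => sum_le_sum fun s _ => ?_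
    split_ifs
    · exact hpair j s
    · simp
  simp_rw [mul_sub, sum_sub_distrib] at hdiff
  unfold CI2
  linarith

theorem outrank_self {X : Type*} {n : ℕ} {m : Fin n → ℝ} {M : Fin n → Fin n → ℝ}
    {g : X → Fin n → ℝ} {F : Fin n → ℝ → ℝ} (hF : ∀ j, F j 0 = 0) (x : X) :
    outrank n m M g F x x = 0 := by
  simp [outrank, CI2, hF]

theorem posFlow_lt_posFlow {X : Type*} [DecidableEq X] {π : X → X → ℝ} {S : Finset X}
    {x y : X} (hself : ∀ z, π z z = 0) (hS : 1 < S.card) (hy : y ∈ S)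
    (hle : ∀ z, π y z ≤ π x z) (hlt : 0 < π x y) :
    posFlow π S y < posFlow π S x := by
  unfold posFlow
  rw [sum_erase S (hself y), sum_erase S (hself x)]
  have hcard : (1 : ℝ) < S.card := by exact_mod_cast hS
  refine mul_lt_mul_of_pos_left ?_ (one_div_pos.2 (sub_pos.2 hcard))
  exact sum_lt_sum (fun z _ => hle z) ⟨y, hy, by rwa [hself y]⟩

/-- Proposition 1, positive flows: the positive Choquet-flows of the
reference profiles strictly decrease along the ordered categories, within
`R_a = {r 0, …, r k, a}`. -/
theorem prop1_posFlow {X : Type*} [DecidableEq X] (n k : ℕ)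
    (m : Fin n → ℝ) (M : Fin n → Fin n → ℝ)
    (hsymm : ∀ j s, M j s = M s j) (hdiag : ∀ j, M j j = 0)
    (hmono1 : ∀ j, 0 ≤ m j)
    (hmono2 : ∀ j (S : Finset (Fin n)), j ∉ S → 0 ≤ m j + ∑ s ∈ S, M j s)
    (g : X → Fin n → ℝ) (F : Fin n → ℝ → ℝ)
    (hF1 : ∀ j, Monotone (F j))
    (hF2 : ∀ j d, 0 ≤ F j d ∧ F j d ≤ 1)
    (hF3 : ∀ j d, d ≤ 0 → F j d = 0)
    (r : Fin (k + 1) → X)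
    (hinj : Function.Injective r)
    (hcond2 : ∀ h l : Fin (k + 1), h < l → ∀ j, g (r l) j ≤ g (r h) j)
    (hcond7B : ∀ h : Fin k,
      0 < outrank n m M g F (r h.castSucc) (r h.succ))
    (a : X) (ha : ∀ h, a ≠ r h) :
    ∀ h : Fin k,
      posFlow (outrank n m M g F) (insert a (Finset.image r Finset.univ)) (r h.succ)
        < posFlow (outrank n m M g F) (insert a (Finset.image r Finset.univ))
          (r h.castSucc) := by
  intro h
  have hmem : ∀ l, r l ∈ insert a (univ.image r) := fun l =>
    mem_insert_of_mem (mem_image_of_mem r (mem_univ l))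
  refine posFlow_lt_posFlow (outrank_self fun j => hF3 j 0 le_rfl)
    (one_lt_card.2 ⟨a, mem_insert_self _ _, r h.succ, hmem _, ha _⟩) (hmem _)
    (fun z => ?_) (hcond7B h)
  refine CI2_mono hsymm hdiag hmono2 fun j => hF1 j ?_
  exact sub_le_sub_right (hcond2 _ _ Fin.castSucc_lt_succ j) _
end

section
/- (Propriety of monotonicity, positive-flow assignment.) Let r : Fin (k+1) → X be limiting profiles, all pairwise distinct, and let a and b be alternatives, each distinct from all profiles. Suppose a dominates b: g a j ≥ g b j for every criterion j. Then for every profile r h, if φ⁺_{R_b}(b) > φ⁺_{R_b}(r h) then φ⁺_{R_a}(a) > φ⁺_{R_a}(r h), where R_a = {r 0, …, r k, a} and R_b = {r 0, …, r k, b}. Consequently a is not assigned by the positive-flow rule to a worse category than b. -/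
open Finset

/-- A linear form bounded below on the indicator vectors is nonnegative on the whole box. -/
theorem add_sum_mul_nonneg_of_subset_sums {ι : Type*} (T : Finset ι) (c δ : ℝ) (w v : ι → ℝ)
    (hδ : 0 ≤ δ) (hw : ∀ S ⊆ T, 0 ≤ c + ∑ s ∈ S, w s)
    (hv0 : ∀ s, 0 ≤ v s) (hv1 : ∀ s, v s ≤ δ) :
    0 ≤ c * δ + ∑ s ∈ T, w s * v s := by
  have h1 := mul_nonneg (hw (T.filter fun s => w s < 0) (Finset.filter_subset _ _)) hδ
  have h2 : (∑ s ∈ T.filter (fun s => w s < 0), w s) * δ ≤ ∑ s ∈ T, w s * v s := by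
    rw [Finset.sum_mul, Finset.sum_filter]
    refine Finset.sum_le_sum fun s _ => ?_
    split_ifs with h
    · exact mul_le_mul_of_nonpos_left (hv1 s) h.le
    · exact mul_nonneg (not_lt.mp h) (hv0 s)
  linarith

theorem CI2_update_sub (n : ℕ) (m : Fin n → ℝ) (M : Fin n → Fin n → ℝ)
    (hsymm : ∀ j s, M j s = M s j) (P : Fin n → ℝ) (j : Fin n) (t : ℝ) :
    CI2 n m M (Function.update P j t) - CI2 n m M P =
      m j * (t - P j) + ∑ s ∈ Finset.univ.erase j, M j s * (min t (P s) - min (P j) (P s)) := by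
  have h1 : ∑ i, m i * Function.update P j t i - ∑ i, m i * P i = m j * (t - P j) := by
    rw [← Finset.sum_sub_distrib, Finset.sum_eq_single j]
    · simp [mul_sub]
    · intro i _ hi
      simp [hi]
    · simp
  have h2 : (∑ i, ∑ s, if i < s then
        M i s * min (Function.update P j t i) (Function.update P j t s) else 0) -
      (∑ i, ∑ s, if i < s then M i s * min (P i) (P s) else 0) =
      ∑ s ∈ Finset.univ.erase j, M j s * (min t (P s) - min (P j) (P s)) := by
    have key : ∀ i s, (if i < s then
          M i s * min (Function.update P j t i) (Function.update P j t s) else 0) -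
        (if i < s then M i s * min (P i) (P s) else 0) =
        (if i = j then if j < s then M j s * (min t (P s) - min (P j) (P s)) else 0 else 0) +
        (if s = j then if i < j then M j i * (min t (P i) - min (P j) (P i)) else 0 else 0) := by
      intro i s
      by_cases hi : i = j
      · subst hi
        by_cases hs : s = i
        · subst hs
          simp
        · by_cases h : i < s <;> simp [hs, h, mul_sub]
      · by_cases hs : s = j
        · subst hs
          by_cases h : i < s <;>
            simp [hi, h, mul_sub, hsymm i s, min_comm (P i)]
        · simp [hi, hs]
    simp only [← Finset.sum_sub_distrib, key, Finset.sum_add_distrib]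
    rw [Finset.sum_comm]
    simp only [Finset.sum_ite_eq', Finset.mem_univ, if_true]
    rw [← Finset.sum_add_distrib, ← Finset.filter_ne', Finset.sum_filter]
    refine Finset.sum_congr rfl fun s _ => ?_
    rcases lt_trichotomy s j with h | h | h
    · simp [h, h.ne, h.not_gt]
    · simp [h]
    · simp [h, h.ne', h.not_gt]
  unfold CI2
  linarith

theorem CI2_le_update (n : ℕ) (m : Fin n → ℝ) (M : Fin n → Fin n → ℝ)
    (hsymm : ∀ j s, M j s = M s j)
    (hmono : ∀ j (S : Finset (Fin n)), j ∉ S → 0 ≤ m j + ∑ s ∈ S, M j s)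
    (P : Fin n → ℝ) (j : Fin n) (t : ℝ) (ht : P j ≤ t) :
    CI2 n m M P ≤ CI2 n m M (Function.update P j t) := by
  rw [← sub_nonneg, CI2_update_sub n m M hsymm]
  refine add_sum_mul_nonneg_of_subset_sums _ _ _ _ _ (sub_nonneg.mpr ht)
    (fun S hS => hmono j S fun hj => Finset.notMem_erase j _ (hS hj)) (fun s => ?_) (fun s => ?_)
  · exact sub_nonneg.mpr (min_le_min_right _ ht)
  · rcases le_total t (P s) with h | h
    · rw [min_eq_left h, min_eq_left (ht.trans h)]
    · rw [min_eq_right h]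
      rcases le_total (P j) (P s) with h' | h'
      · rw [min_eq_left h']
        linarith
      · rw [min_eq_right h']
        linarith

theorem CI2_monotone (n : ℕ) (m : Fin n → ℝ) (M : Fin n → Fin n → ℝ)
    (hsymm : ∀ j s, M j s = M s j)
    (hmono : ∀ j (S : Finset (Fin n)), j ∉ S → 0 ≤ m j + ∑ s ∈ S, M j s) :
    Monotone (CI2 n m M) := by
  intro P Q hPQ
  have key : ∀ T : Finset (Fin n), CI2 n m M P ≤ CI2 n m M (T.piecewise Q P) := by
    intro T
    induction T using Finset.induction_on with
    | empty => simp
    | insert j T hj ih =>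
      rw [Finset.piecewise_insert]
      refine ih.trans (CI2_le_update n m M hsymm hmono _ _ _ ?_)
      simpa [hj] using hPQ j
  simpa using key Finset.univ

theorem posFlow_insert_self {X : Type*} [DecidableEq X] (π : X → X → ℝ) (R : Finset X) (x : X)
    (hx : x ∉ R) : posFlow π (insert x R) x = 1 / (R.card : ℝ) * ∑ y ∈ R, π x y := by
  simp [posFlow, hx]

theorem posFlow_insert_of_mem {X : Type*} [DecidableEq X] (π : X → X → ℝ) (R : Finset X)
    (x y : X) (hx : x ∉ R) (hy : y ∈ R) :
    posFlow π (insert x R) y = 1 / (R.card : ℝ) * (π y x + ∑ z ∈ R.erase y, π y z) := by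
  have hne : x ≠ y := fun h => hx (h ▸ hy)
  rw [posFlow, Finset.erase_insert_of_ne hne, Finset.sum_insert (by simp [hx])]
  simp [hx]

/-- Propriety of monotonicity, positive-flow assignment: if `a`
dominates `b`, then whenever `b`'s positive flow exceeds that of a profile (within
`R_b`), so does `a`'s (within `R_a`); hence `a` is not assigned to a worse category. -/
theorem monotonicity_posFlow_assignment {X : Type*} [DecidableEq X] (n k : ℕ)
    (m : Fin n → ℝ) (M : Fin n → Fin n → ℝ)
    (hsymm : ∀ j s, M j s = M s j) (hdiag : ∀ j, M j j = 0)
    (hmono1 : ∀ j, 0 ≤ m j)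
    (hmono2 : ∀ j (S : Finset (Fin n)), j ∉ S → 0 ≤ m j + ∑ s ∈ S, M j s)
    (g : X → Fin n → ℝ) (F : Fin n → ℝ → ℝ)
    (hF1 : ∀ j, Monotone (F j))
    (hF2 : ∀ j d, 0 ≤ F j d ∧ F j d ≤ 1)
    (hF3 : ∀ j d, d ≤ 0 → F j d = 0)
    (r : Fin (k + 1) → X)
    (hinj : Function.Injective r)
    (a b : X) (ha : ∀ h, a ≠ r h) (hb : ∀ h, b ≠ r h)
    (hdom : ∀ j, g b j ≤ g a j) :
    ∀ h : Fin (k + 1),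
      posFlow (outrank n m M g F) (insert b (Finset.image r Finset.univ)) (r h)
          < posFlow (outrank n m M g F) (insert b (Finset.image r Finset.univ)) b →
        posFlow (outrank n m M g F) (insert a (Finset.image r Finset.univ)) (r h)
          < posFlow (outrank n m M g F) (insert a (Finset.image r Finset.univ)) a := by
  intro h hlt
  have hmon := CI2_monotone n m M hsymm hmono2
  have haR : a ∉ Finset.image r Finset.univ := by simpa using fun i => (ha i).symm
  have hbR : b ∉ Finset.image r Finset.univ := by simpa using fun i => (hb i).symm
  have hrR : r h ∈ Finset.image r Finset.univ := by simp
  rw [posFlow_insert_self _ _ _ hbR, posFlow_insert_of_mem _ _ _ _ hbR hrR] at hlt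
  rw [posFlow_insert_self _ _ _ haR, posFlow_insert_of_mem _ _ _ _ haR hrR]
  refine lt_of_le_of_lt ?_ (lt_of_lt_of_le hlt ?_)
  · gcongr
    exact hmon fun j => hF1 j (sub_le_sub_left (hdom j) _)
  · gcongr with y
    exact hmon fun j => hF1 j (sub_le_sub_right (hdom j) _)
end
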